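/- (Profile likelihood confidence set) Let g : Θ → Ψ be any function, and define the profile likelihood L₀†(ψ) = sup_{θ : g(θ) = ψ} L₀(θ). Then the set B_n = {ψ ∈ Ψ : L₀(θ̂₁)/L₀†(ψ) ≤ 1/α} satisfies P_{θ*}(g(θ*) ∈ B_n) ≥ 1 − α for every θ* ∈ Θ and any α ∈ (0,1). -/

import Mathlib

open MeasureTheory
open scoped ENNReal

open ProbabilityTheory

lemma lintegral_pi_prod_eq_prod_lintegral {ι : Type*} [Fintype ι] {X : ι → Type*}
    {mX : ∀ i, MeasurableSpace (X i)} (ν : ∀ i, Measure (X i)) [∀ i, IsProbabilityMeasure (ν i)]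
    {f : ∀ i, X i → ℝ≥0∞} (hf : ∀ i, Measurable (f i)) :
    ∫⁻ x, ∏ i, f i (x i) ∂Measure.pi ν = ∏ i, ∫⁻ y, f i y ∂ν i := by
  refine (lintegral_prod_eq_prod_lintegral_of_indepFun Finset.univ (fun i (x : ∀ i, X i) ↦ f i (x i))
    (iIndepFun_pi fun i ↦ (hf i).aemeasurable)
    fun i ↦ (hf i).comp (measurable_pi_apply i)).trans ?_
  exact Finset.prod_congr rfl fun i _ ↦ (measurePreserving_eval ν i).lintegral_comp (hf i)

/-- The likelihood ratio integrates to at most the mass of the numerator. -/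
lemma lintegral_div_withDensity_le {X : Type*} [MeasurableSpace X] (μ : Measure X)
    {q r : X → ℝ≥0∞} (hq : Measurable q) (hr : Measurable r) :
    ∫⁻ y, q y / r y ∂μ.withDensity r ≤ ∫⁻ y, q y ∂μ := by
  refine (lintegral_withDensity_eq_lintegral_mul μ hr (hq.div hr)).trans_le ?_
  exact lintegral_mono fun y ↦ ENNReal.mul_div_le

/-- The likelihood ratio of an i.i.d. sample has expectation at most one under the denominator. -/
lemma lintegral_pi_prod_div_prod_le_one {ι X : Type*} [Fintype ι] [MeasurableSpace X]
    (μ : Measure X) {q r : X → ℝ≥0∞} (hq : Measurable q) (hr : Measurable r)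
    (hq1 : ∫⁻ y, q y ∂μ ≤ 1) [IsProbabilityMeasure (μ.withDensity r)] :
    ∫⁻ x, (∏ i, q (x i)) / ∏ i, r (x i) ∂(Measure.pi fun _ : ι ↦ μ.withDensity r) ≤ 1 := by
  have hr_ne_zero : ∀ᵐ y ∂μ.withDensity r, r y ≠ 0 :=
    (ae_withDensity_iff hr).2 (ae_of_all _ fun _ h ↦ h)
  calc
    _ = ∫⁻ x, ∏ i, q (x i) / r (x i) ∂(Measure.pi fun _ : ι ↦ μ.withDensity r) := by
      refine lintegral_congr_ae ?_
      filter_upwards [ae_all_iff.2 fun i ↦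
        Measure.tendsto_eval_ae_ae (μ := fun _ : ι ↦ μ.withDensity r) (i := i) |>.eventually
          hr_ne_zero] with x hx
      exact (ENNReal.prod_div_distrib_of_ne_zero fun i _ ↦ hx i).symm
    _ = ∏ _i : ι, ∫⁻ y, q y / r y ∂μ.withDensity r :=
      lintegral_pi_prod_eq_prod_lintegral (fun _ : ι ↦ μ.withDensity r)
        (f := fun _ y ↦ q y / r y) fun _ ↦ hq.div hr
    _ ≤ 1 := Finset.prod_le_one' fun _ _ ↦ (lintegral_div_withDensity_le μ hq hr).trans hq1

/-- **Profile likelihood confidence set.** For any function `g : Θ → Ψ`,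
with profile likelihood `L₀†(ψ) = ⨆_{θ : g θ = ψ} L₀(θ)` on `D₀` and any estimator
`θ̂₁ = hat1 D₁` measurable in `D₁`, the set `Bₙ = {ψ : L₀(θ̂₁)/L₀†(ψ) ≤ 1/α}` satisfies
`P_{θ*}(g θ* ∈ Bₙ) ≥ 1 − α`. -/
theorem profile_likelihood_confidence_set_coverage
    {𝒴 Θ Ψ : Type*} [MeasurableSpace 𝒴] [MeasurableSpace Θ]
    (μ : Measure 𝒴) [SigmaFinite μ] (n : ℕ)
    (p : Θ → 𝒴 → ℝ≥0∞) (hp_meas : Measurable (Function.uncurry p))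
    (hp1 : ∀ θ, ∫⁻ y, p θ y ∂μ = 1)
    [∀ θ, IsProbabilityMeasure (μ.withDensity (p θ))]
    (g : Θ → Ψ) (θstar : Θ)
    (hat1 : (Fin n → 𝒴) → Θ) (hhat1 : Measurable hat1)
    (α : ℝ) (hα : α ∈ Set.Ioo (0 : ℝ) 1) :
    ENNReal.ofReal (1 - α) ≤
      ((Measure.pi fun _ : Fin n => μ.withDensity (p θstar)).prod
        (Measure.pi fun _ : Fin n => μ.withDensity (p θstar)))
        {ω : (Fin n → 𝒴) × (Fin n → 𝒴) |
          (∏ i, p (hat1 ω.2) (ω.1 i)) /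
            (⨆ θ ∈ {θ' : Θ | g θ' = g θstar}, ∏ i, p θ (ω.1 i))
            ≤ ENNReal.ofReal (1 / α)} := by
  have hp (θ : Θ) : Measurable (p θ) := hp_meas.of_uncurry_left
  set P := Measure.pi fun _ : Fin n => μ.withDensity (p θstar)
  let R : (Fin n → 𝒴) × (Fin n → 𝒴) → ℝ≥0∞ :=
    fun ω ↦ (∏ i, p (hat1 ω.2) (ω.1 i)) / ∏ i, p θstar (ω.1 i)
  have hR : Measurable R := by
    refine Measurable.div (Finset.measurable_fun_prod _ fun i _ ↦ ?_)
      (Finset.measurable_fun_prod _ fun i _ ↦ (hp θstar).comp (by fun_prop))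
    exact hp_meas.comp
      ((hhat1.comp measurable_snd).prodMk ((measurable_pi_apply i).comp measurable_fst))
  have hR_int : ∫⁻ ω, R ω ∂P.prod P ≤ 1 := by
    rw [lintegral_prod_symm' _ hR]
    calc
      _ ≤ ∫⁻ _, 1 ∂P := lintegral_mono fun d ↦
        lintegral_pi_prod_div_prod_le_one μ (hp (hat1 d)) (hp θstar) (hp1 _).le
      _ = 1 := by simp
  have hα_inv : ENNReal.ofReal (1 / α) = (ENNReal.ofReal α)⁻¹ := by
    rw [one_div, ENNReal.ofReal_inv_of_pos hα.1]
  have h_markov : P.prod P {ω | R ω ≤ ENNReal.ofReal (1 / α)}ᶜ ≤ ENNReal.ofReal α := by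
    have h_sub : {ω | R ω ≤ ENNReal.ofReal (1 / α)}ᶜ ⊆ {ω | ENNReal.ofReal (1 / α) ≤ R ω} :=
      by
      intro ω hω
      simp only [Set.mem_compl_iff, Set.mem_ofPred_eq, not_le] at hω ⊢
      exact hω.le
    calc
      _ ≤ P.prod P {ω | ENNReal.ofReal (1 / α) ≤ R ω} := measure_mono h_sub
      _ ≤ (∫⁻ ω, R ω ∂P.prod P) / ENNReal.ofReal (1 / α) :=
        meas_ge_le_lintegral_div hR.aemeasurable (by simp [hα.1]) (by simp)
      _ ≤ 1 / ENNReal.ofReal (1 / α) := by gcongr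
      _ = ENNReal.ofReal α := by rw [hα_inv, one_div, inv_inv]
  calc
    ENNReal.ofReal (1 - α) = 1 - ENNReal.ofReal α := by
      rw [ENNReal.ofReal_sub _ hα.1.le, ENNReal.ofReal_one]
    _ ≤ 1 - P.prod P {ω | R ω ≤ ENNReal.ofReal (1 / α)}ᶜ := tsub_le_tsub_left h_markov 1
    _ = P.prod P {ω | R ω ≤ ENNReal.ofReal (1 / α)} := by
      rw [← prob_compl_eq_one_sub (measurableSet_le hR measurable_const).compl, compl_compl]
    _ ≤ _ := by
      refine measure_mono fun ω hω ↦ ?_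
      have h_le : ∏ i, p θstar (ω.1 i) ≤
          ⨆ θ ∈ {θ' : Θ | g θ' = g θstar}, ∏ i, p θ (ω.1 i) :=
        le_iSup₂ (f := fun θ (_ : θ ∈ {θ' : Θ | g θ' = g θstar}) ↦ ∏ i, p θ (ω.1 i)) θstar rfl
      exact (ENNReal.div_le_div_left h_le _).trans hω
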